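/- Let A be a finite set of points in ℝ^d with |A| = N ≥ 2 and centroid c(A) = (1/|A|) Σ_{x∈A} x. Let 1 ≤ m ≤ N and 0 < δ ≤ 1, and let S be a uniformly random m-element subset of A with centroid c(S) = (1/m) Σ_{y∈S} y. Then with probability at least 1 − δ, Σ_{x∈A} ‖x − c(S)‖² ≤ (1 + (1/(δ m)) · (N−m)/(N−1)) · Σ_{x∈A} ‖x − c(A)‖². -/

import Mathlib

open Finset
open scoped Classical

/-- The centroid `c(A) = (1/|A|) ∑_{x ∈ A} x` of a finite set of points in `ℝ^d`. -/
noncomputable def centroid {d : ℕ} (A : Finset (EuclideanSpace ℝ (Fin d))) :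
    EuclideanSpace ℝ (Fin d) :=
  (A.card : ℝ)⁻¹ • ∑ x ∈ A, x

/-- Double counting of the pairs `t ⊆ S ⊆ A` with `|S| = m`. -/
lemma card_filter_powersetCard_superset_mul_choose {α : Type*} [DecidableEq α]
    {A t : Finset α} (m : ℕ) (ht : t ⊆ A) :
    #((A.powersetCard m).filter (t ⊆ ·)) * (#A).choose #t = (#A).choose m * m.choose #t := by
  rcases le_or_gt #t m with h | h
  · rw [card_filter_powersetCard_subset t A m ht h, Nat.choose_mul h, mul_comm]
  · rw [Nat.choose_eq_zero_of_lt h, mul_zero, filter_eq_empty_iff.mpr, card_empty, zero_mul]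
    intro S hS hsub
    have := card_le_card hsub
    rw [(mem_powersetCard.mp hS).2] at this
    omega

/-- The second moment of the sum of a uniform `m`-sample, drawn without replacement, of a
family with zero total. -/
lemma sum_powersetCard_norm_sum_sq {α E : Type*} [DecidableEq α] [NormedAddCommGroup E]
    [InnerProductSpace ℝ E] (A : Finset α) (f : α → E) (hf : ∑ x ∈ A, f x = 0)
    (hA : 2 ≤ #A) (m : ℕ) :
    ∑ S ∈ A.powersetCard m, ‖∑ x ∈ S, f x‖ ^ 2 =
      (#A).choose m * (m * ((#A : ℝ) - m) / (#A * ((#A : ℝ) - 1))) * ∑ x ∈ A, ‖f x‖ ^ 2 := by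
  have hN : (2 : ℝ) ≤ #A := by exact_mod_cast hA
  have hN0 : (#A : ℝ) ≠ 0 := by linarith
  have hN1 : (#A : ℝ) - 1 ≠ 0 := by linarith
  set p : ℝ := (#A).choose m * (m / #A) with hp
  set q : ℝ := (#A).choose m * (m * ((m : ℝ) - 1) / (#A * ((#A : ℝ) - 1))) with hq
  have hcount : ∀ x ∈ A, ∀ y ∈ A,
      (#((A.powersetCard m).filter ({x, y} ⊆ ·)) : ℝ) = q + if x = y then p - q else 0 := by
    intro x hx y hy
    have ht : ({x, y} : Finset α) ⊆ A := by
      intro z hz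
      rcases mem_insert.mp hz with rfl | hz
      · exact hx
      · exact mem_singleton.mp hz ▸ hy
    have h := congrArg (Nat.cast (R := ℝ)) (card_filter_powersetCard_superset_mul_choose m ht)
    push_cast at h
    by_cases hxy : x = y
    · subst hxy
      rw [pair_eq_singleton, card_singleton, Nat.choose_one_right, Nat.choose_one_right] at h
      rw [pair_eq_singleton, if_pos rfl, hp]
      field_simp
      linarith
    · rw [card_pair hxy, Nat.cast_choose_two, Nat.cast_choose_two] at h
      rw [if_neg hxy, hq]
      field_simp
      linarith
  have hexpand : ∀ S ∈ A.powersetCard m, ‖∑ x ∈ S, f x‖ ^ 2 =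
      ∑ x ∈ A, ∑ y ∈ A, if {x, y} ⊆ S then inner ℝ (f x) (f y) else 0 := by
    intro S hS
    have hSA := (mem_powersetCard.mp hS).1
    rw [← real_inner_self_eq_norm_sq, sum_inner]
    have hrow : ∀ x ∈ A, (∑ y ∈ A, if {x, y} ⊆ S then inner ℝ (f x) (f y) else 0) =
        if x ∈ S then ∑ y ∈ S, inner ℝ (f x) (f y) else 0 := by
      intro x _
      by_cases hx : x ∈ S <;>
        simp [insert_subset_iff, hx, sum_ite_mem, inter_eq_right.mpr hSA]
    rw [sum_congr rfl hrow, sum_ite_mem, inter_eq_right.mpr hSA]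
    simp only [inner_sum]
  rw [sum_congr rfl hexpand, sum_comm]
  have hinner : ∀ x ∈ A, ∑ S ∈ A.powersetCard m, ∑ y ∈ A,
      (if {x, y} ⊆ S then inner ℝ (f x) (f y) else 0) = (p - q) * ‖f x‖ ^ 2 := by
    intro x hx
    rw [sum_comm]
    have : ∀ y ∈ A, ∑ S ∈ A.powersetCard m,
        (if {x, y} ⊆ S then inner ℝ (f x) (f y) else 0) =
        q * inner ℝ (f x) (f y) + if x = y then (p - q) * inner ℝ (f x) (f y) else 0 := by
      intro y hy
      rw [← sum_filter, sum_const, nsmul_eq_mul, hcount x hx y hy]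
      split_ifs <;> ring
    rw [sum_congr rfl this, sum_add_distrib, ← mul_sum, ← inner_sum, hf, inner_zero_right,
      sum_ite_eq, if_pos hx, real_inner_self_eq_norm_sq, mul_zero, zero_add]
  rw [sum_congr rfl hinner, ← mul_sum]
  congr 1
  rw [hp, hq]
  field_simp
  ring

/-- Markov's inequality for the uniform distribution on a finite set. -/
lemma one_sub_mul_card_le_card_filter_le {ι : Type*} (s : Finset ι) (g : ι → ℝ) {a δ : ℝ}
    (hg : ∀ i ∈ s, 0 ≤ g i) (hsum : ∑ i ∈ s, g i = #s * a) (hδ : 0 < δ) :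
    (1 - δ) * #s ≤ #(s.filter (fun i => g i ≤ a / δ)) := by
  have hcard : (#(s.filter (fun i => g i ≤ a / δ)) : ℝ) +
      #(s.filter (fun i => ¬ g i ≤ a / δ)) = #s := by
    exact_mod_cast card_filter_add_card_filter_not (s := s) (fun i => g i ≤ a / δ)
  suffices h : (#(s.filter (fun i => ¬ g i ≤ a / δ)) : ℝ) ≤ δ * #s by linarith
  rcases (s.filter (fun i => ¬ g i ≤ a / δ)).eq_empty_or_nonempty with hB | hB
  · rw [hB, card_empty, Nat.cast_zero]
    positivity
  have hlt : #(s.filter (fun i => ¬ g i ≤ a / δ)) * (a / δ) < #s * a := by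
    rw [← hsum, ← nsmul_eq_mul, ← sum_const]
    exact (sum_lt_sum_of_nonempty hB fun i hi => not_le.mp (mem_filter.mp hi).2).trans_le
      (sum_le_sum_of_subset_of_nonneg (filter_subset _ _) fun i hi _ => hg i hi)
  have ha : 0 ≤ a := by
    have hs : 0 < (#s : ℝ) := by
      exact_mod_cast (hB.mono (filter_subset _ _)).card_pos
    exact nonneg_of_mul_nonneg_right (hsum ▸ sum_nonneg hg) hs
  refine le_of_not_gt fun h => ?_
  have := mul_le_mul_of_nonneg_right h.le (div_nonneg ha hδ.le)
  rw [mul_right_comm, mul_div_cancel₀ _ hδ.ne'] at this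
  linarith

lemma sum_sub_centroid {d : ℕ} (A : Finset (EuclideanSpace ℝ (Fin d))) (hA : #A ≠ 0) :
    ∑ x ∈ A, (x - centroid A) = 0 := by
  have h : (#A : ℝ) ≠ 0 := by exact_mod_cast hA
  rw [sum_sub_distrib, sum_const, _root_.centroid, ← Nat.cast_smul_eq_nsmul ℝ, smul_inv_smul₀ h,
    sub_self]

/-- The bias-variance decomposition of the `1`-means potential. -/
lemma sum_norm_sub_sq_eq_add_centroid {d : ℕ} (A : Finset (EuclideanSpace ℝ (Fin d)))
    (hA : #A ≠ 0) (c : EuclideanSpace ℝ (Fin d)) :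
    ∑ x ∈ A, ‖x - c‖ ^ 2 = ∑ x ∈ A, ‖x - centroid A‖ ^ 2 + #A * ‖c - centroid A‖ ^ 2 := by
  have h : ∀ x ∈ A, ‖x - c‖ ^ 2 = ‖x - centroid A‖ ^ 2
      - 2 * inner ℝ (x - centroid A) (c - centroid A) + ‖c - centroid A‖ ^ 2 := by
    intro x _
    rw [← norm_sub_sq_real, sub_sub_sub_cancel_right]
  rw [sum_congr rfl h, sum_add_distrib, sum_sub_distrib, ← mul_sum, ← sum_inner,
    sum_sub_centroid A hA, inner_zero_left, sum_const, nsmul_eq_mul]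
  ring

/-- The variance of the mean of a uniform `m`-sample drawn without replacement. -/
lemma sum_powersetCard_norm_centroid_sub_sq {d : ℕ} (A : Finset (EuclideanSpace ℝ (Fin d)))
    (hA : 2 ≤ #A) {m : ℕ} (hm : m ≠ 0) :
    ∑ S ∈ A.powersetCard m, #A * ‖centroid S - centroid A‖ ^ 2 =
      #(A.powersetCard m) *
        (((#A : ℝ) - m) / (m * ((#A : ℝ) - 1)) * ∑ x ∈ A, ‖x - centroid A‖ ^ 2) := by
  have hm0 : (m : ℝ) ≠ 0 := by exact_mod_cast hm
  have hN : (2 : ℝ) ≤ #A := by exact_mod_cast hA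
  have hN0 : (#A : ℝ) ≠ 0 := by linarith
  have hN1 : (#A : ℝ) - 1 ≠ 0 := by linarith
  have h : ∀ S ∈ A.powersetCard m, #A * ‖centroid S - centroid A‖ ^ 2 =
      #A / (m : ℝ) ^ 2 * ‖∑ x ∈ S, (x - centroid A)‖ ^ 2 := by
    intro S hS
    have hS : #S = m := (mem_powersetCard.mp hS).2
    have : ∑ x ∈ S, (x - centroid A) = (m : ℝ) • (centroid S - centroid A) := by
      have hcS : (m : ℝ) • centroid S = ∑ x ∈ S, x := by
        rw [_root_.centroid, hS, smul_inv_smul₀ hm0]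
      rw [sum_sub_distrib, sum_const, smul_sub, hcS, hS, Nat.cast_smul_eq_nsmul]
    rw [this, norm_smul, mul_pow, Real.norm_natCast]
    field_simp
  rw [sum_congr rfl h, ← mul_sum,
    sum_powersetCard_norm_sum_sq A _ (sum_sub_centroid A (by omega)) hA, card_powersetCard]
  field_simp

/-- Modified Inaba lemma for sampling without replacement: for a uniformly random
`m`-element subset `S` of `A` (with `|A| = N ≥ 2`, `1 ≤ m ≤ N`, `0 < δ ≤ 1`), with
probability at least `1 − δ`,
`∑_{x∈A} ‖x − c(S)‖² ≤ (1 + (1/(δm))·(N−m)/(N−1)) · ∑_{x∈A} ‖x − c(A)‖²`.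
The probability is expressed by counting the `m`-subsets satisfying the bound. -/
theorem modified_inaba_without_replacement {d : ℕ}
    (A : Finset (EuclideanSpace ℝ (Fin d))) {N m : ℕ} (δ : ℝ)
    (hN : A.card = N) (hN2 : 2 ≤ N) (hm1 : 1 ≤ m) (hmN : m ≤ N)
    (hδ0 : 0 < δ) (hδ1 : δ ≤ 1) :
    (1 - δ) * ((A.powersetCard m).card : ℝ) ≤
      (((A.powersetCard m).filter (fun S =>
          ∑ x ∈ A, ‖x - centroid S‖ ^ 2 ≤
            (1 + (1 / (δ * m)) * (((N : ℝ) - m) / ((N : ℝ) - 1))) *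
              ∑ x ∈ A, ‖x - centroid A‖ ^ 2)).card : ℝ) := by
  subst hN
  have hA : #A ≠ 0 := by omega
  have hm : m ≠ 0 := by omega
  refine (one_sub_mul_card_le_card_filter_le _ _ (fun S _ => by positivity)
    (sum_powersetCard_norm_centroid_sub_sq A hN2 hm) hδ0).trans ?_
  refine Nat.cast_le.mpr (card_le_card (monotone_filter_right _ fun S _ hS => ?_))
  rw [sum_norm_sub_sq_eq_add_centroid A hA, add_mul, one_mul]
  refine add_le_add_right (hS.trans_eq ?_) _
  rw [div_mul_div_comm, one_mul, div_mul_eq_mul_div, div_div, div_mul_eq_mul_div]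
  congr 1
  ring
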